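/- Let (𝓗, 𝒜, P) be a probability space and h : 𝓗×𝓗 → ℝ a measurable symmetric function satisfying the degeneracy condition ∫h(x,y)dP(y) = 0 for all x ∈ 𝓗, with ∫h(x,x)²dP(x) < ∞ and ∫∫h(x,y)²dP(x)dP(y) < ∞. If X₁,…,Xₙ are i.i.d. with law P, then E[ ( ∑_{i,s=1}^n h(X_i,X_s) )² ] = n·∫h(x,x)²dP(x) + 2n(n−1)·∫∫h(x,y)²dP(x)dP(y) + n(n−1)·( ∫h(x,x)dP(x) )². -/

import Mathlib

open MeasureTheory ProbabilityTheory

theorem aux_pair {H : Type*} [MeasurableSpace H] (P : Measure H) [IsProbabilityMeasure P]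
    {Ω : Type*} [MeasurableSpace Ω] (μ : Measure Ω) [IsProbabilityMeasure μ]
    (n : ℕ) (X : Fin n → Ω → H) (hX_meas : ∀ i, Measurable (X i))
    (hX_indep : iIndepFun X μ)
    (hX_law : ∀ i, Measure.map (X i) μ = P) (i s : Fin n) (his : i ≠ s) :
    Measure.map (fun ω => (X i ω, X s ω)) μ = P.prod P := by
  have := (indepFun_iff_map_prod_eq_prod_map_map (hX_meas i).aemeasurable
    (hX_meas s).aemeasurable).1 (hX_indep.indepFun his)
  rw [this, hX_law, hX_law]

theorem aux_memLp {H : Type*} [MeasurableSpace H] (P : Measure H) [IsProbabilityMeasure P]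
    (h : H → H → ℝ) (h_meas : Measurable (Function.uncurry h))
    (h_diag_sq_int : Integrable (fun x => (h x x) ^ 2) P)
    (h_sq_int : Integrable (fun p : H × H => (h p.1 p.2) ^ 2) (P.prod P))
    {Ω : Type*} [MeasurableSpace Ω] (μ : Measure Ω) [IsProbabilityMeasure μ]
    (n : ℕ) (X : Fin n → Ω → H) (hX_meas : ∀ i, Measurable (X i))
    (hX_indep : iIndepFun X μ)
    (hX_law : ∀ i, Measure.map (X i) μ = P) (i s : Fin n) :
    MemLp (fun ω => h (X i ω) (X s ω)) 2 μ := by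
  have hm : Measurable (fun ω => h (X i ω) (X s ω)) :=
    h_meas.comp ((hX_meas i).prodMk (hX_meas s))
  rw [memLp_two_iff_integrable_sq hm.aestronglyMeasurable]
  by_cases his : i = s
  · subst his
    rw [← hX_law i] at h_diag_sq_int
    exact h_diag_sq_int.comp_measurable (hX_meas i)
  · rw [← aux_pair P μ n X hX_meas hX_indep hX_law i s his] at h_sq_int
    exact h_sq_int.comp_measurable ((hX_meas i).prodMk (hX_meas s))

theorem aux_zero {H : Type*} [MeasurableSpace H] (P : Measure H) [IsProbabilityMeasure P]
    (h : H → H → ℝ) (h_meas : Measurable (Function.uncurry h))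
    (h_deg : ∀ x, ∫ y, h x y ∂P = 0)
    (h_diag_sq_int : Integrable (fun x => (h x x) ^ 2) P)
    (h_sq_int : Integrable (fun p : H × H => (h p.1 p.2) ^ 2) (P.prod P))
    {Ω : Type*} [MeasurableSpace Ω] (μ : Measure Ω) [IsProbabilityMeasure μ]
    (n : ℕ) (X : Fin n → Ω → H) (hX_meas : ∀ i, Measurable (X i))
    (hX_indep : iIndepFun X μ)
    (hX_law : ∀ i, Measure.map (X i) μ = P) (i s j t : Fin n)
    (h1 : i ≠ t) (h2 : s ≠ t) (h3 : j ≠ t) :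
    ∫ ω, h (X i ω) (X s ω) * h (X j ω) (X t ω) ∂μ = 0 := by
  have hint : Integrable (fun ω => h (X i ω) (X s ω) * h (X j ω) (X t ω)) μ :=
    (aux_memLp P h h_meas h_diag_sq_int h_sq_int μ n X hX_meas hX_indep hX_law i s).integrable_mul
    (aux_memLp P h h_meas h_diag_sq_int h_sq_int μ n X hX_meas hX_indep hX_law j t)
  have hind := hX_indep.indepFun_finset ({i, s, j} : Finset (Fin n)) {t}
    (by simp [h1.symm, h2.symm, h3.symm]) hX_meas
  have hi : i ∈ ({i, s, j} : Finset (Fin n)) := by simp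
  have hs : s ∈ ({i, s, j} : Finset (Fin n)) := by simp
  have hj : j ∈ ({i, s, j} : Finset (Fin n)) := by simp
  have ht : t ∈ ({t} : Finset (Fin n)) := by simp
  have hind2 : IndepFun (fun ω => (X i ω, X s ω, X j ω)) (X t) μ :=
    hind.comp
      (φ := fun z : ({i, s, j} : Finset (Fin n)) → H =>
        (z ⟨i, hi⟩, z ⟨s, hs⟩, z ⟨j, hj⟩))
      (ψ := fun z : ({t} : Finset (Fin n)) → H => z ⟨t, ht⟩)
      ((measurable_pi_apply _).prodMk ((measurable_pi_apply _).prodMk (measurable_pi_apply _)))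
      (measurable_pi_apply _)
  have hZ : Measurable (fun ω => (X i ω, X s ω, X j ω)) :=
    (hX_meas i).prodMk ((hX_meas s).prodMk (hX_meas j))
  have hmap := (indepFun_iff_map_prod_eq_prod_map_map hZ.aemeasurable
    (hX_meas t).aemeasurable).1 hind2
  rw [hX_law] at hmap
  have : IsProbabilityMeasure (μ.map (fun ω => (X i ω, X s ω, X j ω))) :=
    Measure.isProbabilityMeasure_map hZ.aemeasurable
  let F : (H × H × H) × H → ℝ := fun p => h p.1.1 p.1.2.1 * h p.1.2.2 p.2
  have hF : Measurable F := by
    apply Measurable.mul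
    · exact h_meas.comp (f := fun p : (H × H × H) × H => (p.1.1, p.1.2.1)) (by fun_prop)
    · exact h_meas.comp (f := fun p : (H × H × H) × H => (p.1.2.2, p.2)) (by fun_prop)
  have hZt := hZ.prodMk (hX_meas t)
  have hFi : Integrable F ((μ.map (fun ω => (X i ω, X s ω, X j ω))).prod P) := by
    rw [← hmap, integrable_map_measure hF.aestronglyMeasurable hZt.aemeasurable]
    exact hint
  have h4 : ∫ ω, h (X i ω) (X s ω) * h (X j ω) (X t ω) ∂μ
      = ∫ p, F p ∂((μ.map (fun ω => (X i ω, X s ω, X j ω))).prod P) := by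
    rw [← hmap, integral_map hZt.aemeasurable hF.aestronglyMeasurable]
  rw [h4, integral_prod _ hFi]
  simp only [F, integral_const_mul, h_deg, mul_zero, integral_zero]

theorem stmt17 {H : Type*} [MeasurableSpace H] (P : Measure H) [IsProbabilityMeasure P]
    (h : H → H → ℝ) (h_meas : Measurable (Function.uncurry h))
    (h_symm : ∀ x y, h x y = h y x)
    (h_deg : ∀ x, ∫ y, h x y ∂P = 0)
    (h_diag_sq_int : Integrable (fun x => (h x x) ^ 2) P)
    (h_sq_int : Integrable (fun p : H × H => (h p.1 p.2) ^ 2) (P.prod P))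
    {Ω : Type*} [MeasurableSpace Ω] (μ : Measure Ω) [IsProbabilityMeasure μ]
    (n : ℕ) (X : Fin n → Ω → H) (hX_meas : ∀ i, Measurable (X i))
    (hX_indep : iIndepFun X μ)
    (hX_law : ∀ i, Measure.map (X i) μ = P) :
    ∫ ω, (∑ i, ∑ s, h (X i ω) (X s ω)) ^ 2 ∂μ
      = (n : ℝ) * ∫ x, (h x x) ^ 2 ∂P
        + 2 * (n : ℝ) * ((n : ℝ) - 1) * ∫ x, ∫ y, (h x y) ^ 2 ∂P ∂P
        + (n : ℝ) * ((n : ℝ) - 1) * (∫ x, h x x ∂P) ^ 2 := by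
  have hL := aux_memLp P h h_meas h_diag_sq_int h_sq_int μ n X hX_meas hX_indep hX_law
  have hint : ∀ i s j t, Integrable (fun ω => h (X i ω) (X s ω) * h (X j ω) (X t ω)) μ :=
    fun i s j t => (hL i s).integrable_mul (hL j t)
  have hz := aux_zero P h h_meas h_deg h_diag_sq_int h_sq_int μ n X hX_meas hX_indep hX_law
  have hd : Measurable (fun x => h x x) :=
    h_meas.comp (f := fun x : H => (x, x)) (by fun_prop)
  set A := ∫ x, (h x x) ^ 2 ∂P with hA
  set B := ∫ x, h x x ∂P with hB
  set C := ∫ x, ∫ y, (h x y) ^ 2 ∂P ∂P with hC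
  have eA : ∀ i, ∫ ω, h (X i ω) (X i ω) * h (X i ω) (X i ω) ∂μ = A := by
    intro i
    rw [hA, ← hX_law i, integral_map (hX_meas i).aemeasurable
      (hd.pow_const 2).aestronglyMeasurable]
    simp only [sq]
  have eB1 : ∀ i, ∫ ω, h (X i ω) (X i ω) ∂μ = B := by
    intro i
    rw [hB, ← hX_law i, integral_map (hX_meas i).aemeasurable hd.aestronglyMeasurable]
  have eB : ∀ i j, i ≠ j → ∫ ω, h (X i ω) (X i ω) * h (X j ω) (X j ω) ∂μ = B ^ 2 := by
    intro i j hij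
    have := ((hX_indep.indepFun hij).comp hd hd).integral_fun_mul_eq_mul_integral
      (hd.comp (hX_meas i)).aestronglyMeasurable (hd.comp (hX_meas j)).aestronglyMeasurable
    simp only [Function.comp_apply, eB1] at this
    rw [this, sq]
  have eC : ∀ i j, i ≠ j → ∫ ω, h (X i ω) (X j ω) * h (X i ω) (X j ω) ∂μ = C := by
    intro i j hij
    have hm : Measurable (fun p : H × H => (h p.1 p.2) ^ 2) := h_meas.pow_const 2
    have e : C = ∫ p, (h p.1 p.2) ^ 2 ∂(P.prod P) := (integral_prod _ h_sq_int).symm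
    rw [e, ← aux_pair P μ n X hX_meas hX_indep hX_law i j hij,
      integral_map ((hX_meas i).prodMk (hX_meas j)).aemeasurable hm.aestronglyMeasurable]
    simp only [sq]
  have key : ∀ i s j t, ∫ ω, h (X i ω) (X s ω) * h (X j ω) (X t ω) ∂μ =
      (if i = s then if j = t then B ^ 2 else 0 else 0)
      + (if i = s then if i = j then if i = t then A - B ^ 2 - 2 * C else 0 else 0 else 0)
      + (if i = j then if s = t then C else 0 else 0)
      + (if i = t then if s = j then C else 0 else 0) := by
    intro i s j t
    have zt : i ≠ t → s ≠ t → j ≠ t → ∫ ω, h (X i ω) (X s ω) * h (X j ω) (X t ω) ∂μ = 0 :=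
      hz i s j t
    have zj : i ≠ j → s ≠ j → t ≠ j → ∫ ω, h (X i ω) (X s ω) * h (X j ω) (X t ω) ∂μ = 0 := by
      intro a b c
      rw [← hz i s t j a b c]
      simp only [h_symm (X j _) (X t _)]
    have zs : j ≠ s → t ≠ s → i ≠ s → ∫ ω, h (X i ω) (X s ω) * h (X j ω) (X t ω) ∂μ = 0 := by
      intro a b c
      rw [← hz j t i s a b c]
      simp only [mul_comm]
    have zi : j ≠ i → t ≠ i → s ≠ i → ∫ ω, h (X i ω) (X s ω) * h (X j ω) (X t ω) ∂μ = 0 := by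
      intro a b c
      rw [← hz j t s i a b c]
      simp only [h_symm (X i _) (X s _), mul_comm]
    have eC' : i ≠ s → ∫ ω, h (X i ω) (X s ω) * h (X s ω) (X i ω) ∂μ = C := by
      intro a
      rw [← eC i s a]
      simp only [h_symm (X s _) (X i _)]
    by_cases his : i = s
    · subst his
      by_cases hjt : j = t
      · subst hjt
        by_cases hij : i = j
        · subst hij
          rw [eA]; simp; ring
        · rw [eB i j hij]; simp [hij]
      · by_cases hij : i = j
        · subst hij
          rw [zt hjt hjt hjt]; simp [hjt]
        · rw [zj hij hij (Ne.symm hjt)]; simp [hij, hjt]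
    · by_cases hij : i = j
      · subst hij
        by_cases hst : s = t
        · subst hst
          rw [eC i s his]; simp [his]
        · by_cases hit : i = t
          · subst hit
            rw [zs his his his]; simp [his, Ne.symm his]
          · rw [zt hit hst hit]; simp [his, hst, hit]
      · by_cases hit : i = t
        · subst hit
          by_cases hsj : s = j
          · subst hsj
            rw [eC' his]; simp [his]
          · rw [zj hij hsj hij]; simp [his, hij, hsj]
        · rw [zi (Ne.symm hij) (Ne.symm hit) (Ne.symm his)]; simp [his, hij, hit]
  have expand : ∀ ω, (∑ i, ∑ s, h (X i ω) (X s ω)) ^ 2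
      = ∑ i, ∑ s, ∑ j, ∑ t, h (X i ω) (X s ω) * h (X j ω) (X t ω) := by
    intro ω
    rw [sq]
    simp only [Finset.sum_mul, Finset.mul_sum]
    refine Finset.sum_congr rfl fun i _ => Finset.sum_congr rfl fun s _ =>
      Finset.sum_congr rfl fun j _ => Finset.sum_congr rfl fun t _ => mul_comm _ _
  simp only [expand]
  have : ∫ ω, ∑ i, ∑ s, ∑ j, ∑ t, h (X i ω) (X s ω) * h (X j ω) (X t ω) ∂μ
      = ∑ i, ∑ s, ∑ j, ∑ t, ∫ ω, h (X i ω) (X s ω) * h (X j ω) (X t ω) ∂μ := by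
    rw [integral_finsetSum _ fun i _ => integrable_finsetSum _ fun s _ =>
      integrable_finsetSum _ fun j _ => integrable_finsetSum _ fun t _ => hint i s j t]
    refine Finset.sum_congr rfl fun i _ => ?_
    rw [integral_finsetSum _ fun s _ =>
      integrable_finsetSum _ fun j _ => integrable_finsetSum _ fun t _ => hint i s j t]
    refine Finset.sum_congr rfl fun s _ => ?_
    rw [integral_finsetSum _ fun j _ => integrable_finsetSum _ fun t _ => hint i s j t]
    refine Finset.sum_congr rfl fun j _ => ?_
    rw [integral_finsetSum _ fun t _ => hint i s j t]
  rw [this]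
  simp only [key, Finset.sum_add_distrib]
  have s1 : ∑ i : Fin n, ∑ s : Fin n, ∑ j : Fin n, ∑ t : Fin n,
      (if i = s then if j = t then B ^ 2 else 0 else 0) = n * n * B ^ 2 := by
    have : ∀ i s : Fin n, ∑ j : Fin n, ∑ t : Fin n,
      (if i = s then if j = t then B ^ 2 else 0 else 0) = if i = s then n * B ^ 2 else 0 := by
      intro i s
      split_ifs <;> simp
    simp [this]; ring
  have s2 (c : ℝ) : ∑ i : Fin n, ∑ s : Fin n, ∑ j : Fin n, ∑ t : Fin n,
      (if i = s then if i = j then if i = t then c else 0 else 0 else 0) = n * c := by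
    have : ∀ i s : Fin n, ∑ j : Fin n, ∑ t : Fin n,
      (if i = s then if i = j then if i = t then c else 0 else 0 else 0)
        = if i = s then c else 0 := by
      intro i s
      split_ifs
      · have : ∀ j : Fin n, ∑ t : Fin n, (if i = j then if i = t then c else 0 else 0)
          = if i = j then c else 0 := by
          intro j; split_ifs <;> simp
        simp [this]
      · simp
    simp [this]
  have s3 : ∑ i : Fin n, ∑ s : Fin n, ∑ j : Fin n, ∑ t : Fin n,
      (if i = j then if s = t then C else 0 else 0) = n * n * C := by
    have : ∀ i s j : Fin n, ∑ t : Fin n,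
      (if i = j then if s = t then C else 0 else 0) = if i = j then C else 0 := by
      intro i s j
      split_ifs <;> simp
    simp [this]; ring
  have s4 : ∑ i : Fin n, ∑ s : Fin n, ∑ j : Fin n, ∑ t : Fin n,
      (if i = t then if s = j then C else 0 else 0) = n * n * C := by
    simp; ring
  rw [s1, s2, s3, s4]
  ring
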